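/- arXiv:2109.06294 — 3 statements merged into one kernel-verified Lean document; each statement's English description precedes it below -/
import Mathlib

section
/- Let p ∈ [2, ∞) with conjugate exponent q = p/(p−1), let N be a norm on ℝ^d with dual norm N_*, let μ₀ be a Borel probability measure on ℝ^d with bounded support, and let j : ℝ^d × Θ → ℝ be such that for every θ ∈ Θ the map x ↦ j(x,θ) is twice continuously differentiable with operator norm of the Hessian D²_x j(x,θ) bounded by a constant C uniformly over all x ∈ ℝ^d and θ ∈ Θ; assume also that inf_{θ ∈ Θ} ∫ j(x,θ) dμ₀(x) > −∞. Define V*_δ = inf_{θ ∈ Θ} sup_{π ∈ F_{μ₀,δ}} ∫ j(x̃,θ) dπ(x,x̃) and U*_δ = inf_{θ ∈ Θ} { ∫ j(x,θ) dμ₀(x) + δ · ( ∫ N_*(∇_x j(x,θ))^q dμ₀(x) )^{1/q} }. Then there exists a constant C′, depending only on C, d and N, such that for every δ > 0: |V*_δ − U*_δ| ≤ C′ δ². -/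
open MeasureTheory Real
open scoped RealInnerProductSpace

section NormFacts

variable {E : Type*} [NormedAddCommGroup E] [InnerProductSpace ℝ E]

/-- The function dual to `N` with respect to the inner product. -/
noncomputable def dualGauge (N : E → ℝ) (y : E) : ℝ :=
  sSup {r : ℝ | ∃ x, N x ≤ 1 ∧ r = ⟪y, x⟫}

lemma nonneg_of_subadditive_of_abs_homogeneous {N : E → ℝ}
    (hsmul : ∀ (a : ℝ) (x : E), N (a • x) = |a| * N x)
    (hadd : ∀ x y, N (x + y) ≤ N x + N y) (x : E) : 0 ≤ N x := by
  have h0 : N 0 = 0 := by simpa using hsmul 0 0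
  have h1 : N (-x) = N x := by simpa using hsmul (-1) x
  have h2 := hadd x (-x)
  rw [add_neg_cancel, h0, h1] at h2
  linarith

lemma continuous_of_subadditive_of_abs_homogeneous [FiniteDimensional ℝ E] {N : E → ℝ}
    (hsmul : ∀ (a : ℝ) (x : E), N (a • x) = |a| * N x)
    (hadd : ∀ x y, N (x + y) ≤ N x + N y) : Continuous N := by
  have hconv : ConvexOn ℝ Set.univ N := by
    refine ⟨convex_univ, fun x _ y _ a b ha hb _ => ?_⟩
    refine (hadd _ _).trans ?_
    rw [hsmul, hsmul, abs_of_nonneg ha, abs_of_nonneg hb, smul_eq_mul, smul_eq_mul]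
  exact hconv.locallyLipschitz.continuous

lemma exists_norm_le_mul_of_abs_homogeneous [FiniteDimensional ℝ E] {N : E → ℝ}
    (h0 : ∀ x, N x = 0 ↔ x = 0)
    (hsmul : ∀ (a : ℝ) (x : E), N (a • x) = |a| * N x)
    (hnonneg : ∀ x, 0 ≤ N x) (hcont : Continuous N) :
    ∃ c : ℝ, 0 < c ∧ ∀ x, ‖x‖ ≤ c * N x := by
  rcases (Metric.sphere (0 : E) 1).eq_empty_or_nonempty with hS | hS
  · refine ⟨1, one_pos, fun x => ?_⟩
    have hx : x = 0 := by
      by_contra hx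
      have : ‖x‖⁻¹ • x ∈ Metric.sphere (0 : E) 1 := by
        simp [norm_smul, hx]
      simp [hS] at this
    simpa [hx] using hnonneg 0
  · obtain ⟨u, hu, hmin⟩ := (isCompact_sphere (0 : E) 1).exists_isMinOn hS hcont.continuousOn
    have hNu : 0 < N u := by
      refine lt_of_le_of_ne (hnonneg u) fun h => ?_
      have : u = 0 := (h0 u).1 h.symm
      simp [this] at hu
    refine ⟨(N u)⁻¹, inv_pos.2 hNu, fun x => ?_⟩
    by_cases hx : x = 0
    · rw [hx, norm_zero]
      exact mul_nonneg (inv_pos.2 hNu).le (hnonneg 0)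
    have hx' : 0 < ‖x‖ := norm_pos_iff.2 hx
    have hmem : ‖x‖⁻¹ • x ∈ Metric.sphere (0 : E) 1 := by
      simp [norm_smul, hx]
    have hle : N u ≤ N (‖x‖⁻¹ • x) := hmin hmem
    rw [hsmul, abs_of_pos (inv_pos.2 hx')] at hle
    rw [inv_mul_eq_div, le_div_iff₀ hNu]
    calc ‖x‖ * N u ≤ ‖x‖ * (‖x‖⁻¹ * N x) := by gcongr
      _ = N x := by field_simp

variable {N : E → ℝ} {c : ℝ}

lemma bddAbove_dualGauge (hc : 0 ≤ c) (hle : ∀ x, ‖x‖ ≤ c * N x) (y : E) :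
    BddAbove {r : ℝ | ∃ x, N x ≤ 1 ∧ r = ⟪y, x⟫} := by
  refine ⟨‖y‖ * c, ?_⟩
  rintro r ⟨x, hx, rfl⟩
  refine (real_inner_le_norm y x).trans ?_
  gcongr
  nlinarith [hle x]

lemma inner_le_dualGauge (hc : 0 ≤ c) (hle : ∀ x, ‖x‖ ≤ c * N x) (y : E) {x : E}
    (hx : N x ≤ 1) : ⟪y, x⟫ ≤ dualGauge N y :=
  le_csSup (bddAbove_dualGauge hc hle y) ⟨x, hx, rfl⟩

lemma dualGauge_nonneg (h0 : N 0 = 0) (hc : 0 ≤ c) (hle : ∀ x, ‖x‖ ≤ c * N x) (y : E) :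
    0 ≤ dualGauge N y := by
  simpa using inner_le_dualGauge hc hle y (x := 0) (by simp [h0])

lemma inner_le_dualGauge_mul (h0 : N 0 = 0)
    (hsmul : ∀ (a : ℝ) (x : E), N (a • x) = |a| * N x) (hnonneg : ∀ x, 0 ≤ N x)
    (hc : 0 ≤ c) (hle : ∀ x, ‖x‖ ≤ c * N x) (y x : E) :
    ⟪y, x⟫ ≤ dualGauge N y * N x := by
  rcases (hnonneg x).eq_or_lt with h | h
  · have hx : x = 0 := by
      have := hle x
      rw [← h, mul_zero] at this
      exact norm_le_zero_iff.1 this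
    simp [hx, h0]
  · have h1 := inner_le_dualGauge hc hle y (x := (N x)⁻¹ • x)
      (by rw [hsmul, abs_of_pos (inv_pos.2 h), inv_mul_cancel₀ h.ne'])
    rw [inner_smul_right, inv_mul_eq_div, div_le_iff₀ h] at h1
    exact h1

lemma continuous_dualGauge (h0 : N 0 = 0) (hc : 0 ≤ c) (hle : ∀ x, ‖x‖ ≤ c * N x) :
    Continuous (dualGauge N) := by
  refine (LipschitzWith.of_le_add_mul ⟨c, hc⟩ fun y z => ?_).continuous
  refine csSup_le ⟨0, 0, by simp [h0], by simp⟩ ?_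
  rintro r ⟨x, hx, rfl⟩
  have h1 : ⟪y, x⟫ = ⟪z, x⟫ + ⟪y - z, x⟫ := by rw [inner_sub_left]; ring
  rw [h1, dist_eq_norm, mul_comm]
  refine add_le_add (inner_le_dualGauge hc hle z hx) ((real_inner_le_norm _ _).trans ?_)
  exact mul_le_mul_of_nonneg_left ((hle x).trans (mul_le_of_le_one_right hc hx)) (norm_nonneg _)

/-- Measurable choice of almost maximizers in the definition of the dual gauge. -/
lemma exists_measurable_almost_maximizer [FiniteDimensional ℝ E] [MeasurableSpace E]
    [BorelSpace E] (h0 : N 0 = 0) (hc : 0 ≤ c)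
    (hle : ∀ x, ‖x‖ ≤ c * N x) {ε : ℝ} (hε : 0 < ε) :
    ∃ T : E → E, Measurable T ∧ (∀ y, N (T y) ≤ 1) ∧ ∀ y, dualGauge N y - ε ≤ ⟪y, T y⟫ := by
  classical
  let B : Set E := {x | N x ≤ 1}
  have : Nonempty B := ⟨⟨0, by simp [B, h0]⟩⟩
  let s : ℕ → B := TopologicalSpace.denseSeq B
  have hex : ∀ y : E, ∃ n, dualGauge N y - ε < ⟪y, (s n : E)⟫ := by
    intro y
    obtain ⟨r, ⟨x, hx, rfl⟩, hr⟩ := exists_lt_of_lt_csSup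
      (s := {r : ℝ | ∃ x, N x ≤ 1 ∧ r = ⟪y, x⟫}) ⟨0, 0, by simp [h0], by simp⟩
      (show dualGauge N y - ε < _ from sub_lt_self _ hε)
    have hopen : IsOpen {b : B | dualGauge N y - ε < ⟪y, (b : E)⟫} :=
      isOpen_lt continuous_const (by fun_prop)
    obtain ⟨b, hb, n, rfl⟩ :=
      (TopologicalSpace.denseRange_denseSeq B).inter_open_nonempty _ hopen ⟨⟨x, hx⟩, hr⟩
    exact ⟨n, hb⟩
  have hmeas : Measurable fun y => Nat.find (hex y) := by
    refine measurable_find hex fun k => ?_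
    exact measurableSet_lt ((continuous_dualGauge h0 hc hle).measurable.sub_const ε)
      (by fun_prop)
  refine ⟨fun y => (s (Nat.find (hex y)) : E), ?_, fun y => (s (Nat.find (hex y))).2,
    fun y => (Nat.find_spec (hex y)).le⟩
  exact (measurable_from_nat (f := fun n => (s n : E))).comp hmeas

end NormFacts

lemma continuous_gradient_of_contDiff {E : Type*} [NormedAddCommGroup E] [InnerProductSpace ℝ E]
    [CompleteSpace E] {f : E → ℝ} (hf : ContDiff ℝ 2 f) : Continuous (gradient f) :=
  (InnerProductSpace.toDual ℝ E).symm.continuous.comp (hf.continuous_fderiv (by norm_num))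

lemma abs_sub_sub_inner_gradient_le {E : Type*} [NormedAddCommGroup E] [InnerProductSpace ℝ E]
    [CompleteSpace E] {f : E → ℝ} (hf : ContDiff ℝ 2 f) {C : ℝ}
    (hC : ∀ x, ‖iteratedFDeriv ℝ 2 f x‖ ≤ C) (x y : E) :
    |f y - f x - ⟪gradient f x, y - x⟫| ≤ C * ‖y - x‖ ^ 2 := by
  have hC0 : 0 ≤ C := (norm_nonneg _).trans (hC 0)
  have hd : ContDiff ℝ 1 (fderiv ℝ f) := hf.fderiv_right (by norm_num)
  have h1 : ∀ z, ‖fderiv ℝ (fderiv ℝ f) z‖ ≤ C := by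
    intro z
    have h := hC z
    rw [← norm_iteratedFDeriv_fderiv (n := 1), ← norm_iteratedFDeriv_fderiv (n := 0),
      norm_iteratedFDeriv_zero] at h
    exact h
  have h2 : ∀ z ∈ segment ℝ x y, ‖fderiv ℝ f z - fderiv ℝ f x‖ ≤ C * ‖y - x‖ := by
    intro z hz
    refine (convex_univ.norm_image_sub_le_of_norm_fderiv_le (𝕜 := ℝ)
      (fun w _ => (hd.differentiable (by norm_num)) w) (fun w _ => h1 w)
      (Set.mem_univ x) (Set.mem_univ z)).trans ?_
    gcongr
    simpa [dist_eq_norm, norm_sub_rev] using norm_sub_le_of_mem_segment hz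
  have h3 := (convex_segment x y).norm_image_sub_le_of_norm_fderiv_le' (𝕜 := ℝ)
    (fun w _ => (hf.differentiable (by norm_num)) w) h2
    (left_mem_segment ℝ x y) (right_mem_segment ℝ x y)
  rw [← inner_gradient_left, Real.norm_eq_abs] at h3
  linarith

lemma sq_le_sq_mul_one_add_rpow {p t δ : ℝ} (hp : 2 ≤ p) (ht : 0 ≤ t) (hδ : 0 < δ) :
    t ^ 2 ≤ δ ^ 2 * (1 + t ^ p / δ ^ p) := by
  have hpow : 0 ≤ t ^ p / δ ^ p := by positivity
  rcases le_total t δ with h | h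
  · nlinarith [pow_le_pow_left₀ ht h 2, sq_nonneg δ]
  · have h1 : 1 ≤ t / δ := (one_le_div hδ).2 h
    have h2 := Real.rpow_le_rpow_of_exponent_le h1 hp
    rw [Real.rpow_two, Real.div_rpow ht hδ.le, div_pow, div_le_iff₀ (by positivity)] at h2
    nlinarith [sq_nonneg δ]

lemma exists_bound_of_continuous {E F : Type*} [NormedAddCommGroup E]
    [ProperSpace E] [MeasurableSpace E] [NormedAddCommGroup F] {μ : Measure E}
    (hμ : ∃ K : Set E, Bornology.IsBounded K ∧ μ Kᶜ = 0) {g : E → F} (hg : Continuous g) :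
    ∃ M : ℝ, 0 ≤ M ∧ ∀ᵐ x ∂μ, ‖g x‖ ≤ M := by
  obtain ⟨K, hK, hK0⟩ := hμ
  obtain ⟨M, hM⟩ := hK.isCompact_closure.exists_bound_of_continuousOn hg.continuousOn
  refine ⟨max M 0, le_max_right _ _, ?_⟩
  have : ∀ᵐ x ∂μ, x ∈ K := hK0
  filter_upwards [this] with x hx
  exact (hM x (subset_closure hx)).trans (le_max_left _ _)

section Transport

variable {E : Type*} [NormedAddCommGroup E] [InnerProductSpace ℝ E] [FiniteDimensional ℝ E]
  [MeasurableSpace E] [BorelSpace E]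

lemma integrable_rpow_cost {N : E → ℝ} (hcont : Continuous N) (hnonneg : ∀ x, 0 ≤ N x)
    {p δ : ℝ} (hδ : 0 < δ) {ν : Measure (E × E)}
    (hcost : (∫⁻ z, ENNReal.ofReal (N (z.2 - z.1) ^ p) ∂ν) ≤ ENNReal.ofReal (δ ^ p)) :
    Integrable (fun z : E × E => N (z.2 - z.1) ^ p) ν ∧
      ∫ z, N (z.2 - z.1) ^ p ∂ν ≤ δ ^ p := by
  have hm : Measurable fun z : E × E => N (z.2 - z.1) ^ p := by
    have : Continuous fun z : E × E => N (z.2 - z.1) := by fun_prop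
    exact this.measurable.pow_const p
  have hnn : ∀ z : E × E, 0 ≤ N (z.2 - z.1) ^ p := fun z => Real.rpow_nonneg (hnonneg _) _
  have hint : Integrable (fun z : E × E => N (z.2 - z.1) ^ p) ν :=
    ⟨hm.aestronglyMeasurable, by
      rw [hasFiniteIntegral_iff_ofReal (Filter.Eventually.of_forall hnn)]
      exact hcost.trans_lt ENNReal.ofReal_lt_top⟩
  refine ⟨hint, ?_⟩
  rw [← ofReal_integral_eq_lintegral_ofReal hint (Filter.Eventually.of_forall hnn)] at hcost
  exact (ENNReal.ofReal_le_ofReal_iff (by positivity)).1 hcost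

lemma integrable_sq_cost {N : E → ℝ} (hcont : Continuous N) (hnonneg : ∀ x, 0 ≤ N x)
    {p δ : ℝ} (hp : 2 ≤ p) (hδ : 0 < δ) {ν : Measure (E × E)} [IsProbabilityMeasure ν]
    (hcost : (∫⁻ z, ENNReal.ofReal (N (z.2 - z.1) ^ p) ∂ν) ≤ ENNReal.ofReal (δ ^ p)) :
    Integrable (fun z : E × E => N (z.2 - z.1) ^ 2) ν ∧
      ∫ z, N (z.2 - z.1) ^ 2 ∂ν ≤ 2 * δ ^ 2 := by
  obtain ⟨hint, hle⟩ := integrable_rpow_cost hcont hnonneg hδ hcost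
  have hb : Integrable (fun z : E × E => δ ^ 2 * (1 + N (z.2 - z.1) ^ p / δ ^ p)) ν :=
    ((integrable_const _).add (hint.div_const _)).const_mul _
  have hpt : ∀ z : E × E, N (z.2 - z.1) ^ 2 ≤ δ ^ 2 * (1 + N (z.2 - z.1) ^ p / δ ^ p) :=
    fun z => sq_le_sq_mul_one_add_rpow hp (hnonneg _) hδ
  have hint2 : Integrable (fun z : E × E => N (z.2 - z.1) ^ 2) ν := by
    refine hb.mono' (by fun_prop) (Filter.Eventually.of_forall fun z => ?_)
    rw [Real.norm_of_nonneg (sq_nonneg _)]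
    exact hpt z
  refine ⟨hint2, (integral_mono hint2 hb hpt).trans ?_⟩
  rw [integral_const_mul, integral_add (integrable_const _) (hint.div_const _), integral_div]
  have : (∫ z, N (z.2 - z.1) ^ p ∂ν) / δ ^ p ≤ 1 := (div_le_one (by positivity)).2 hle
  simp only [integral_const, probReal_univ, smul_eq_mul, mul_one]
  nlinarith [sq_nonneg δ]

/-- First-order expansion of the transported expectation, with quadratic remainder. -/
lemma abs_integral_sub_sub_integral_inner_le {N : E → ℝ} (hcont : Continuous N)
    (hnonneg : ∀ x, 0 ≤ N x) {c : ℝ} (hle : ∀ x, ‖x‖ ≤ c * N x)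
    {p δ : ℝ} (hp : 2 ≤ p) (hδ : 0 < δ) {μ : Measure E}
    (hμ : ∃ K : Set E, Bornology.IsBounded K ∧ μ Kᶜ = 0)
    {ν : Measure (E × E)} [IsProbabilityMeasure ν] (hfst : ν.map Prod.fst = μ)
    (hcost : (∫⁻ z, ENNReal.ofReal (N (z.2 - z.1) ^ p) ∂ν) ≤ ENNReal.ofReal (δ ^ p))
    {f : E → ℝ} {G : E → E} (hf : Continuous f) (hG : Continuous G) {C : ℝ} (hC : 0 ≤ C)
    (hfG : ∀ x y, |f y - f x - ⟪G x, y - x⟫| ≤ C * ‖y - x‖ ^ 2) :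
    Integrable (fun z : E × E => ⟪G z.1, z.2 - z.1⟫) ν ∧
      |∫ z, f z.2 ∂ν - ∫ x, f x ∂μ - ∫ z, ⟪G z.1, z.2 - z.1⟫ ∂ν| ≤ 2 * C * c ^ 2 * δ ^ 2 := by
  obtain ⟨hint2, hle2⟩ := integrable_sq_cost hcont hnonneg hp hδ hcost
  have hfst' : ∀ {P : E → Prop}, (∀ᵐ x ∂μ, P x) → ∀ᵐ z ∂ν, P z.1 := by
    intro P hP
    rw [← hfst] at hP
    exact ae_of_ae_map measurable_fst.aemeasurable hP
  obtain ⟨M₁, hM₁, hb₁⟩ := exists_bound_of_continuous hμ hf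
  obtain ⟨M₂, hM₂, hb₂⟩ := exists_bound_of_continuous hμ hG
  have hsq : ∀ z : E × E, ‖z.2 - z.1‖ ^ 2 ≤ c ^ 2 * N (z.2 - z.1) ^ 2 := fun z => by
    rw [← mul_pow]
    exact pow_le_pow_left₀ (norm_nonneg _) (hle _) 2
  have hi1 : Integrable (fun z : E × E => f z.1) ν :=
    Integrable.of_bound (by fun_prop) M₁ (hfst' hb₁)
  have hi2 : Integrable (fun z : E × E => ⟪G z.1, z.2 - z.1⟫) ν := by
    refine Integrable.mono' (((integrable_const 1).add (hint2.const_mul (c ^ 2))).const_mul M₂)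
      (by fun_prop) ?_
    filter_upwards [hfst' hb₂] with z hz
    refine (norm_inner_le_norm _ _).trans ?_
    refine mul_le_mul hz ?_ (norm_nonneg _) hM₂
    simp only [Pi.add_apply]
    nlinarith [hsq z, sq_nonneg (‖z.2 - z.1‖ - 1)]
  have hi3b : Integrable (fun z : E × E => C * (c ^ 2 * N (z.2 - z.1) ^ 2)) ν :=
    (hint2.const_mul _).const_mul _
  have hpt : ∀ z : E × E, ‖f z.2 - f z.1 - ⟪G z.1, z.2 - z.1⟫‖ ≤
      C * (c ^ 2 * N (z.2 - z.1) ^ 2) := fun z => by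
    rw [Real.norm_eq_abs]
    exact (hfG _ _).trans (mul_le_mul_of_nonneg_left (hsq z) hC)
  have hi3 : Integrable (fun z : E × E => f z.2 - f z.1 - ⟪G z.1, z.2 - z.1⟫) ν :=
    hi3b.mono' (by fun_prop) (Filter.Eventually.of_forall hpt)
  have hi4 : Integrable (fun z : E × E => f z.2) ν := by
    refine ((hi3.add hi2).add hi1).congr (Filter.Eventually.of_forall fun z => ?_)
    simp
  refine ⟨hi2, ?_⟩
  have hfm : ∫ x, f x ∂μ = ∫ z, f z.1 ∂ν := by
    rw [← hfst, integral_map measurable_fst.aemeasurable hf.aestronglyMeasurable]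
  have hsplit : ∫ z, f z.2 ∂ν - ∫ z, f z.1 ∂ν - ∫ z, ⟪G z.1, z.2 - z.1⟫ ∂ν =
      ∫ z, (f z.2 - f z.1 - ⟪G z.1, z.2 - z.1⟫) ∂ν := by
    rw [← integral_sub hi4 hi1]
    exact (integral_sub (hi4.sub hi1) hi2).symm
  rw [hfm, hsplit, ← Real.norm_eq_abs]
  refine (norm_integral_le_of_norm_le hi3b (Filter.Eventually.of_forall hpt)).trans ?_
  rw [integral_const_mul, integral_const_mul]
  have := mul_le_mul_of_nonneg_left hle2 (mul_nonneg hC (sq_nonneg c))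
  linarith

/-- The transported expectation is bounded by the gradient-regularized risk. -/
lemma integral_le_gradient_regularization {N : E → ℝ}
    (hsmul : ∀ (a : ℝ) (x : E), N (a • x) = |a| * N x) (hcont : Continuous N)
    (hnonneg : ∀ x, 0 ≤ N x) {c : ℝ} (hc : 0 ≤ c) (hle : ∀ x, ‖x‖ ≤ c * N x)
    {p q δ : ℝ} (hp : 2 ≤ p) (hpq : p.HolderConjugate q) (hδ : 0 < δ) {μ : Measure E}
    (hμ : ∃ K : Set E, Bornology.IsBounded K ∧ μ Kᶜ = 0)
    {ν : Measure (E × E)} [IsProbabilityMeasure ν] (hfst : ν.map Prod.fst = μ)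
    (hcost : (∫⁻ z, ENNReal.ofReal (N (z.2 - z.1) ^ p) ∂ν) ≤ ENNReal.ofReal (δ ^ p))
    {f : E → ℝ} {G : E → E} (hf : Continuous f) (hG : Continuous G) {C : ℝ} (hC : 0 ≤ C)
    (hfG : ∀ x y, |f y - f x - ⟪G x, y - x⟫| ≤ C * ‖y - x‖ ^ 2) :
    ∫ z, f z.2 ∂ν ≤ (∫ x, f x ∂μ + δ * (∫ x, dualGauge N (G x) ^ q ∂μ) ^ (1 / q))
      + 2 * C * c ^ 2 * δ ^ 2 := by
  have h0 : N 0 = 0 := by simpa using hsmul 0 0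
  obtain ⟨hi, hexp⟩ := abs_integral_sub_sub_integral_inner_le hcont hnonneg hle hp hδ hμ
    hfst hcost hf hG hC hfG
  obtain ⟨hip, hlep⟩ := integrable_rpow_cost hcont hnonneg hδ hcost
  have hDc : Continuous fun x => dualGauge N (G x) := (continuous_dualGauge h0 hc hle).comp hG
  have hD0 : ∀ y, 0 ≤ dualGauge N y := dualGauge_nonneg h0 hc hle
  obtain ⟨M, hM, hb⟩ := exists_bound_of_continuous hμ hDc
  have hbν : ∀ᵐ z ∂ν, ‖dualGauge N (G z.1)‖ ≤ M := by
    rw [← hfst] at hb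
    exact ae_of_ae_map measurable_fst.aemeasurable hb
  have hmD : MemLp (fun z : E × E => dualGauge N (G z.1)) (ENNReal.ofReal q) ν :=
    MemLp.of_bound (hDc.comp continuous_fst).aestronglyMeasurable M hbν
  have hcN : Continuous fun z : E × E => N (z.2 - z.1) := by fun_prop
  have hmN : MemLp (fun z : E × E => N (z.2 - z.1)) (ENNReal.ofReal p) ν := by
    rw [← integrable_norm_rpow_iff hcN.aestronglyMeasurable
      (by simpa using hpq.pos) ENNReal.ofReal_ne_top, ENNReal.toReal_ofReal hpq.nonneg]
    simpa only [Real.norm_of_nonneg (hnonneg _)] using hip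
  have hholder := integral_mul_le_Lp_mul_Lq_of_nonneg hpq.symm
    (Filter.Eventually.of_forall fun z : E × E => hD0 (G z.1))
    (Filter.Eventually.of_forall fun z : E × E => hnonneg (z.2 - z.1)) hmD hmN
  have hprod : Integrable (fun z : E × E => dualGauge N (G z.1) * N (z.2 - z.1)) ν := by
    have := hpq.symm.ennrealOfReal
    exact hmD.integrable_mul hmN
  have hinner : ∫ z, ⟪G z.1, z.2 - z.1⟫ ∂ν ≤ ∫ z, dualGauge N (G z.1) * N (z.2 - z.1) ∂ν :=
    integral_mono hi hprod fun z => inner_le_dualGauge_mul h0 hsmul hnonneg hc hle _ _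
  have hmap : ∫ z : E × E, dualGauge N (G z.1) ^ q ∂ν = ∫ x, dualGauge N (G x) ^ q ∂μ := by
    rw [← hfst, integral_map measurable_fst.aemeasurable
      (hDc.measurable.pow_const q).aestronglyMeasurable]
  have hroot : (∫ z, N (z.2 - z.1) ^ p ∂ν) ^ (1 / p) ≤ δ := by
    refine (Real.rpow_le_rpow (integral_nonneg fun z => Real.rpow_nonneg (hnonneg _) _) hlep
      (by have := hpq.pos; positivity)).trans ?_
    rw [← Real.rpow_mul hδ.le, mul_one_div_cancel hpq.ne_zero, Real.rpow_one]
  rw [hmap] at hholder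
  have hI : 0 ≤ (∫ x, dualGauge N (G x) ^ q ∂μ) ^ (1 / q) :=
    Real.rpow_nonneg (integral_nonneg fun x => Real.rpow_nonneg (hD0 _) _) _
  have := mul_le_mul_of_nonneg_left hroot hI
  have := (abs_le.1 hexp).2
  linarith

/-- Up to `ε` and a quadratic term, the gradient-regularized risk is attained by a transport. -/
lemma exists_transport_gradient_regularization_le {N : E → ℝ}
    (hsmul : ∀ (a : ℝ) (x : E), N (a • x) = |a| * N x) (hcont : Continuous N)
    (hnonneg : ∀ x, 0 ≤ N x) {c : ℝ} (hc : 0 ≤ c) (hle : ∀ x, ‖x‖ ≤ c * N x)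
    {p q δ : ℝ} (hp : 2 ≤ p) (hpq : p.HolderConjugate q) (hδ : 0 < δ) {μ : Measure E}
    [IsProbabilityMeasure μ]
    (hμ : ∃ K : Set E, Bornology.IsBounded K ∧ μ Kᶜ = 0)
    {f : E → ℝ} {G : E → E} (hf : Continuous f) (hG : Continuous G) {C : ℝ} (hC : 0 ≤ C)
    (hfG : ∀ x y, |f y - f x - ⟪G x, y - x⟫| ≤ C * ‖y - x‖ ^ 2) {ε : ℝ} (hε : 0 < ε) :
    ∃ ν : Measure (E × E), IsProbabilityMeasure ν ∧ ν.map Prod.fst = μ ∧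
      (∫⁻ z, ENNReal.ofReal (N (z.2 - z.1) ^ p) ∂ν) ≤ ENNReal.ofReal (δ ^ p) ∧
      (∫ x, f x ∂μ + δ * (∫ x, dualGauge N (G x) ^ q ∂μ) ^ (1 / q))
        - 2 * C * c ^ 2 * δ ^ 2 - ε ≤ ∫ z, f z.2 ∂ν := by
  have h0 : N 0 = 0 := by simpa using hsmul 0 0
  have hDc : Continuous fun x => dualGauge N (G x) := (continuous_dualGauge h0 hc hle).comp hG
  have hD0 : ∀ y, 0 ≤ dualGauge N y := dualGauge_nonneg h0 hc hle
  obtain ⟨M, hM, hb⟩ := exists_bound_of_continuous hμ hDc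
  have hpow : ∀ r : ℝ, 0 ≤ r → Integrable (fun x => dualGauge N (G x) ^ r) μ := fun r hr =>
    Integrable.of_bound (hDc.measurable.pow_const r).aestronglyMeasurable (M ^ r) (by
      filter_upwards [hb] with x hx
      rw [Real.norm_of_nonneg (hD0 _)] at hx
      rw [Real.norm_of_nonneg (Real.rpow_nonneg (hD0 _) _)]
      exact Real.rpow_le_rpow (hD0 _) hx hr)
  have hq1 : 0 < q - 1 := hpq.symm.sub_one_pos
  set I : ℝ := ∫ x, dualGauge N (G x) ^ q ∂μ with hI
  have hI0 : 0 ≤ I := integral_nonneg fun x => Real.rpow_nonneg (hD0 _) _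
  suffices H : ∃ h : E → E, Measurable h ∧
      (∫⁻ x, ENNReal.ofReal (N (h x) ^ p) ∂μ) ≤ ENNReal.ofReal (δ ^ p) ∧
      δ * I ^ (1 / q) - ε ≤ ∫ x, ⟪G x, h x⟫ ∂μ by
    obtain ⟨h, hm, hcost, hgain⟩ := H
    have hφ : Measurable fun x => (x, x + h x) := by fun_prop
    have hfst : (μ.map fun x => (x, x + h x)).map Prod.fst = μ := by
      rw [Measure.map_map measurable_fst hφ]
      exact Measure.map_id
    have hprob : IsProbabilityMeasure (μ.map fun x => (x, x + h x)) :=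
      Measure.isProbabilityMeasure_map hφ.aemeasurable
    have hcostν : (∫⁻ z, ENNReal.ofReal (N (z.2 - z.1) ^ p) ∂(μ.map fun x => (x, x + h x)))
        ≤ ENNReal.ofReal (δ ^ p) := by
      have hcN : Continuous fun z : E × E => N (z.2 - z.1) := by fun_prop
      rw [lintegral_map (hcN.measurable.pow_const p).ennreal_ofReal hφ]
      simpa using hcost
    refine ⟨_, hprob, hfst, hcostν, ?_⟩
    obtain ⟨-, hexp⟩ := abs_integral_sub_sub_integral_inner_le hcont hnonneg hle hp hδ hμ
      hfst hcostν hf hG hC hfG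
    have hcG : Continuous fun z : E × E => ⟪G z.1, z.2 - z.1⟫ := by fun_prop
    rw [integral_map hφ.aemeasurable hcG.aestronglyMeasurable] at hexp
    simp only [add_sub_cancel_left] at hexp
    have := (abs_le.1 hexp).1
    linarith
  rcases hI0.eq_or_lt with hIz | hIpos
  · refine ⟨fun _ => 0, measurable_const, ?_, ?_⟩
    · simp [h0, Real.zero_rpow hpq.ne_zero]
    · rw [← hIz, Real.zero_rpow (one_div_ne_zero hpq.symm.ne_zero)]
      simpa using hε.le
  · have hA : 0 < I ^ (1 / p) := Real.rpow_pos_of_pos hIpos _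
    let s : E → ℝ := fun x => δ / I ^ (1 / p) * dualGauge N (G x) ^ (q - 1)
    have hs0 : ∀ x, 0 ≤ s x := fun x =>
      mul_nonneg (by positivity) (Real.rpow_nonneg (hD0 _) _)
    have hsi : Integrable s μ := (hpow _ hq1.le).const_mul _
    have hsm : Measurable s := (hDc.measurable.pow_const _).const_mul _
    have hS : 0 ≤ ∫ x, s x ∂μ := integral_nonneg hs0
    have hε' : 0 < ε / (∫ x, s x ∂μ + 1) := by positivity
    obtain ⟨T, hT, hT1, hTε⟩ := exists_measurable_almost_maximizer h0 hc hle hε'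
    have hTG : Measurable fun x => T (G x) := hT.comp hG.measurable
    refine ⟨fun x => s x • T (G x), hsm.smul hTG, ?_, ?_⟩
    · have hpt : ∀ x, N (s x • T (G x)) ^ p ≤ δ ^ p / I * dualGauge N (G x) ^ q := by
        intro x
        rw [hsmul, abs_of_nonneg (hs0 x)]
        refine (Real.rpow_le_rpow (mul_nonneg (hs0 x) (hnonneg _))
          (mul_le_of_le_one_right (hs0 x) (hT1 _)) hpq.nonneg).trans (le_of_eq ?_)
        rw [Real.mul_rpow (by positivity) (Real.rpow_nonneg (hD0 _) _),
          Real.div_rpow hδ.le hA.le, ← Real.rpow_mul hI0, one_div_mul_cancel hpq.ne_zero,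
          Real.rpow_one, ← Real.rpow_mul (hD0 _), mul_comm (q - 1) p,
          mul_sub, mul_one, hpq.mul_eq_add, add_sub_cancel_left]
      have hbi : Integrable (fun x => δ ^ p / I * dualGauge N (G x) ^ q) μ :=
        (hpow q hpq.symm.nonneg).const_mul _
      calc (∫⁻ x, ENNReal.ofReal (N (s x • T (G x)) ^ p) ∂μ)
          ≤ ∫⁻ x, ENNReal.ofReal (δ ^ p / I * dualGauge N (G x) ^ q) ∂μ :=
            lintegral_mono fun x => ENNReal.ofReal_le_ofReal (hpt x)
        _ = ENNReal.ofReal (∫ x, δ ^ p / I * dualGauge N (G x) ^ q ∂μ) :=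
            (ofReal_integral_eq_lintegral_ofReal hbi (Filter.Eventually.of_forall fun x =>
              mul_nonneg (by positivity) (Real.rpow_nonneg (hD0 _) _))).symm
        _ = ENNReal.ofReal (δ ^ p) := by
            rw [integral_const_mul, ← hI, div_mul_cancel₀ _ hIpos.ne']
    · have hsD : ∀ x, s x * dualGauge N (G x) = δ / I ^ (1 / p) * dualGauge N (G x) ^ q := by
        intro x
        simp only [s]
        rw [mul_assoc]
        congr 1
        rcases (hD0 (G x)).eq_or_lt with hz | hz
        · rw [← hz, mul_zero, Real.zero_rpow hpq.symm.ne_zero]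
        · rw [Real.rpow_sub_one hz.ne', div_mul_cancel₀ _ hz.ne']
      have hi1 : Integrable (fun x => δ / I ^ (1 / p) * dualGauge N (G x) ^ q) μ :=
        (hpow q hpq.symm.nonneg).const_mul _
      obtain ⟨B, hB, hbG⟩ := exists_bound_of_continuous hμ hG
      have hinner : Integrable (fun x => ⟪G x, s x • T (G x)⟫) μ := by
        refine (hsi.const_mul (B * c)).mono'
          (hG.measurable.inner (hsm.smul hTG)).aestronglyMeasurable ?_
        filter_upwards [hbG] with x hx
        have hTc : ‖T (G x)‖ ≤ c := (hle _).trans (mul_le_of_le_one_right hc (hT1 _))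
        refine (norm_inner_le_norm _ _).trans ?_
        rw [norm_smul, Real.norm_of_nonneg (hs0 x)]
        calc ‖G x‖ * (s x * ‖T (G x)‖) ≤ B * (s x * c) := by
              have := hs0 x
              gcongr
          _ = B * c * s x := by ring
      have hlow : ∫ x, (δ / I ^ (1 / p) * dualGauge N (G x) ^ q
          - s x * (ε / (∫ x, s x ∂μ + 1))) ∂μ ≤ ∫ x, ⟪G x, s x • T (G x)⟫ ∂μ := by
        refine integral_mono (hi1.sub (hsi.mul_const _)) hinner fun x => ?_
        simp only
        rw [inner_smul_right, ← hsD, ← mul_sub]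
        exact mul_le_mul_of_nonneg_left (hTε _) (hs0 x)
      refine le_trans ?_ hlow
      rw [integral_sub hi1 (hsi.mul_const _), integral_const_mul, integral_mul_const, ← hI]
      have hpw : δ / I ^ (1 / p) * I = δ * I ^ (1 / q) := by
        have : I = I ^ (1 / p) * I ^ (1 / q) := by
          rw [← Real.rpow_add hIpos, one_div, one_div, hpq.inv_add_inv_eq_one, Real.rpow_one]
        rw [div_mul_eq_mul_div, div_eq_iff hA.ne']
        nth_rewrite 1 [this]
        ring
      have herr : (∫ x, s x ∂μ) * (ε / (∫ x, s x ∂μ + 1)) ≤ ε := by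
        rw [mul_div_assoc', div_le_iff₀ (by positivity)]
        nlinarith
      linarith

end Transport

lemma abs_ciInf_sub_ciInf_le {ι : Type*} [Nonempty ι] {a b : ι → ℝ} {K : ℝ}
    (h : ∀ i, |a i - b i| ≤ K) (hb : BddBelow (Set.range b)) :
    |(⨅ i, a i) - ⨅ i, b i| ≤ K := by
  obtain ⟨m, hm⟩ := hb
  have hbm : ∀ i, m ≤ b i := fun i => hm ⟨i, rfl⟩
  have ha : BddBelow (Set.range a) := by
    refine ⟨m - K, ?_⟩
    rintro _ ⟨i, rfl⟩
    have := (abs_le.1 (h i)).1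
    linarith [hbm i]
  rw [abs_le]
  constructor
  · have : (⨅ i, b i) - K ≤ ⨅ i, a i := le_ciInf fun i => by
      have := ciInf_le ⟨m, hm⟩ i
      linarith [(abs_le.1 (h i)).1]
    linarith
  · have : (⨅ i, a i) - K ≤ ⨅ i, b i := le_ciInf fun i => by
      have := ciInf_le ha i
      linarith [(abs_le.1 (h i)).2]
    linarith

/-- **First-order regularization of distributionally robust learning** (Theorem 2.1, second part).
With `V*_δ` the min-max robust value and `U*_δ` the value of the gradient-regularized risk
minimization problem, one has `|V*_δ − U*_δ| ≤ C' δ²` with `C'` depending only on the Hessian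
bound `C`, the dimension `d`, and the norm `N`. -/
theorem stmt_1
    {d : ℕ} {Θ : Type*} [Nonempty Θ]
    (p q : ℝ) (hp : 2 ≤ p) (hq : q = p / (p - 1))
    (N Nstar : EuclideanSpace ℝ (Fin d) → ℝ)
    (hN0 : ∀ x, N x = 0 ↔ x = 0)
    (hNsmul : ∀ (a : ℝ) (x : EuclideanSpace ℝ (Fin d)), N (a • x) = |a| * N x)
    (hNadd : ∀ x y, N (x + y) ≤ N x + N y)
    (hNstar : ∀ y, Nstar y = sSup {r : ℝ | ∃ x, N x ≤ 1 ∧ r = ⟪y, x⟫})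
    (C : ℝ) :
    ∃ C' : ℝ,
      ∀ (μ₀ : Measure (EuclideanSpace ℝ (Fin d))), IsProbabilityMeasure μ₀ →
      (∃ K : Set (EuclideanSpace ℝ (Fin d)), Bornology.IsBounded K ∧ μ₀ Kᶜ = 0) →
      ∀ (j : EuclideanSpace ℝ (Fin d) → Θ → ℝ),
      (∀ θ, ContDiff ℝ 2 (fun x => j x θ)) →
      (∀ θ x, ‖iteratedFDeriv ℝ 2 (fun y => j y θ) x‖ ≤ C) →
      BddBelow (Set.range fun θ : Θ => ∫ x, j x θ ∂μ₀) →
      ∀ δ : ℝ, 0 < δ →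
      |(⨅ θ : Θ, sSup {r : ℝ |
          ∃ ν : Measure (EuclideanSpace ℝ (Fin d) × EuclideanSpace ℝ (Fin d)),
            IsProbabilityMeasure ν ∧ ν.map Prod.fst = μ₀ ∧
            (∫⁻ z, ENNReal.ofReal (N (z.2 - z.1) ^ p) ∂ν) ≤ ENNReal.ofReal (δ ^ p) ∧
            r = ∫ z, j z.2 θ ∂ν})
        - (⨅ θ : Θ, (∫ x, j x θ ∂μ₀
            + δ * (∫ x, Nstar (gradient (fun y => j y θ) x) ^ q ∂μ₀) ^ (1 / q)))|
      ≤ C' * δ ^ 2 := by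
  obtain rfl : Nstar = dualGauge N := funext hNstar
  have hnonneg := nonneg_of_subadditive_of_abs_homogeneous hNsmul hNadd
  have hcont := continuous_of_subadditive_of_abs_homogeneous hNsmul hNadd
  obtain ⟨c, hc, hle⟩ := exists_norm_le_mul_of_abs_homogeneous hN0 hNsmul hnonneg hcont
  have hN00 : N 0 = 0 := (hN0 0).2 rfl
  have hpq : p.HolderConjugate q := by
    rw [hq]
    exact Real.HolderConjugate.conjExponent (by linarith)
  refine ⟨2 * C * c ^ 2, fun μ₀ _ hμ j hj hhess hbdd δ hδ => ?_⟩
  have hC : 0 ≤ C := (norm_nonneg _).trans (hhess (Classical.arbitrary Θ) 0)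
  refine abs_ciInf_sub_ciInf_le (fun θ => ?_) ?_
  · have hG := continuous_gradient_of_contDiff (hj θ)
    have hfG := abs_sub_sub_inner_gradient_le (hj θ) (hhess θ)
    have hub : ∀ r ∈ {r : ℝ | ∃ ν : Measure (EuclideanSpace ℝ (Fin d) × EuclideanSpace ℝ (Fin d)),
        IsProbabilityMeasure ν ∧ ν.map Prod.fst = μ₀ ∧
        (∫⁻ z, ENNReal.ofReal (N (z.2 - z.1) ^ p) ∂ν) ≤ ENNReal.ofReal (δ ^ p) ∧
        r = ∫ z, j z.2 θ ∂ν},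
        r ≤ (∫ x, j x θ ∂μ₀ + δ * (∫ x, dualGauge N (gradient (fun y => j y θ) x) ^ q ∂μ₀)
          ^ (1 / q)) + 2 * C * c ^ 2 * δ ^ 2 := by
      rintro r ⟨ν, hν, hfst, hcost, rfl⟩
      exact integral_le_gradient_regularization hNsmul hcont hnonneg hc.le hle hp hpq hδ hμ hfst
        hcost (hj θ).continuous hG hC hfG
    have hlb := fun (ε : ℝ) (hε : 0 < ε) =>
      exists_transport_gradient_regularization_le hNsmul hcont hnonneg hc.le hle hp hpq hδ hμ
        (hj θ).continuous hG hC hfG hε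
    rw [abs_le]
    constructor
    · rw [neg_le_sub_iff_le_add]
      refine le_of_forall_pos_le_add fun ε hε => ?_
      obtain ⟨ν, hν, hfst, hcost, hval⟩ := hlb ε hε
      have := le_csSup ⟨_, hub⟩ ⟨ν, hν, hfst, hcost, rfl⟩
      linarith
    · obtain ⟨ν, hν, hfst, hcost, -⟩ := hlb 1 one_pos
      exact sub_le_iff_le_add'.2 (csSup_le ⟨_, ν, hν, hfst, hcost, rfl⟩ hub)
  · obtain ⟨m, hm⟩ := hbdd
    refine ⟨m, ?_⟩
    rintro _ ⟨θ, rfl⟩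
    have h1 : m ≤ ∫ x, j x θ ∂μ₀ := hm ⟨θ, rfl⟩
    have h2 : 0 ≤ δ * (∫ x, dualGauge N (gradient (fun y => j y θ) x) ^ q ∂μ₀) ^ (1 / q) :=
      mul_nonneg hδ.le (Real.rpow_nonneg (integral_nonneg fun x =>
        Real.rpow_nonneg (dualGauge_nonneg hN00 hc.le hle _) _) _)
    simp only
    linarith
end

section
/- Let ‖·‖ be a norm on ℝ^d, let μ₀ be a Borel probability measure on ℝ^d with bounded support, let j : ℝ^d → ℝ be bounded and continuous, let r ≥ 1 and δ > 0. Let F be the set of Borel probability measures π on ℝ^d × ℝ^d whose first marginal is μ₀ and which satisfy ∫ ‖x − x̃‖^r dπ(x,x̃) ≤ δ^r, and for γ ≥ 0 define j^γ(x) = sup_{x̃ ∈ ℝ^d} { j(x̃) − γ ‖x − x̃‖^r }. Then sup_{π ∈ F} ∫ j(x̃) dπ(x,x̃) = inf_{γ ≥ 0} { γ δ^r + ∫ j^γ(x) dμ₀(x) }. Moreover, if π* attains the supremum on the left-hand side, then there exists γ* ≥ 0 attaining the infimum on the right-hand side such that for π*-almost every (x, x*): x* ∈ argmax_{x̃ ∈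 ℝ^d} { j(x̃) − γ* ‖x − x̃‖^r }. -/
open MeasureTheory Real

/-- A planar convex set whose points left of `b` lie below height `V`, and which has a point strictly
left of `b`, lies below a nondecreasing line through `(b, V)`. -/
theorem exists_nonneg_slope_of_convex {S : Set (ℝ × ℝ)} (hS : Convex ℝ S) {b V : ℝ}
    (hne : ∃ p ∈ S, p.1 < b) (hle : ∀ p ∈ S, p.1 ≤ b → p.2 ≤ V) :
    ∃ γ : ℝ, 0 ≤ γ ∧ ∀ p ∈ S, p.2 - V ≤ γ * (p.1 - b) := by
  have key : ∀ p ∈ S, ∀ q ∈ S, p.1 < b → b < q.1 →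
      (q.2 - V) / (q.1 - b) ≤ (V - p.2) / (b - p.1) := by
    intro p hp q hq hpb hqb
    have hpq : 0 < q.1 - p.1 := by linarith
    have hmem := hS hp hq (a := (q.1 - b) / (q.1 - p.1)) (b := (b - p.1) / (q.1 - p.1))
      (div_nonneg (by linarith) hpq.le) (div_nonneg (by linarith) hpq.le)
      (by field_simp; ring)
    have h := hle _ hmem (by
      simp only [Prod.fst_add, Prod.smul_fst, smul_eq_mul]
      apply le_of_eq; field_simp; ring)
    simp only [Prod.snd_add, Prod.smul_snd, smul_eq_mul] at h
    rw [div_mul_eq_mul_div, div_mul_eq_mul_div, ← add_div, div_le_iff₀ hpq] at h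
    rw [div_le_div_iff₀ (by linarith) (by linarith)]
    nlinarith
  set A : Set ℝ := insert 0 {s | ∃ q ∈ S, b < q.1 ∧ s = (q.2 - V) / (q.1 - b)} with hA
  have hub : ∀ p ∈ S, p.1 < b → (V - p.2) / (b - p.1) ∈ upperBounds A := by
    rintro p hp hpb s (rfl | ⟨q, hq, hqb, rfl⟩)
    · exact div_nonneg (by linarith [hle p hp hpb.le]) (by linarith)
    · exact key p hp q hq hpb hqb
  have hbdd : BddAbove A := by
    obtain ⟨p, hp, hpb⟩ := hne
    exact ⟨_, hub p hp hpb⟩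
  refine ⟨sSup A, le_csSup hbdd (Set.mem_insert _ _), fun p hp => ?_⟩
  rcases lt_trichotomy p.1 b with h | h | h
  · have h1 := csSup_le ⟨0, Set.mem_insert _ _⟩ (hub p hp h)
    rw [le_div_iff₀ (by linarith)] at h1
    linarith
  · have := hle p hp h.le
    simp only [h, sub_self, mul_zero]
    linarith
  · have h1 : (p.2 - V) / (p.1 - b) ≤ sSup A :=
      le_csSup hbdd (Set.mem_insert_of_mem _ ⟨p, hp, h, rfl⟩)
    rwa [div_le_iff₀ (by linarith)] at h1

/-- The penalized supremum `x ↦ sup_y (j y - γ c(x, y))`. -/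
noncomputable def penalizedSup {E : Type*} (c : E → E → ℝ) (j : E → ℝ) (γ : ℝ) (x : E) : ℝ :=
  sSup {s : ℝ | ∃ y, s = j y - γ * c x y}

/-- Couplings with first marginal `μ` and transport cost at most `b`. -/
structure IsFeasibleCoupling {E : Type*} [MeasurableSpace E] (c : E → E → ℝ) (μ : Measure E) (b : ℝ)
    (ν : Measure (E × E)) : Prop where
  prob : IsProbabilityMeasure ν
  fst : ν.map Prod.fst = μ
  integrable : Integrable (fun z : E × E => c z.1 z.2) ν
  cost : ∫ z, c z.1 z.2 ∂ν ≤ b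

section Pointwise

variable {E : Type*} {c : E → E → ℝ} {j : E → ℝ} {M γ : ℝ}

theorem bddAbove_penalized (hc0 : ∀ x y, 0 ≤ c x y) (hjb : ∀ x, |j x| ≤ M) (hγ : 0 ≤ γ) (x : E) :
    BddAbove {s : ℝ | ∃ y, s = j y - γ * c x y} := by
  refine ⟨M, ?_⟩
  rintro s ⟨y, rfl⟩
  linarith [(abs_le.1 (hjb y)).2, mul_nonneg hγ (hc0 x y)]

theorem le_penalizedSup (hc0 : ∀ x y, 0 ≤ c x y) (hjb : ∀ x, |j x| ≤ M) (hγ : 0 ≤ γ) (x y : E) :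
    j y - γ * c x y ≤ penalizedSup c j γ x :=
  le_csSup (bddAbove_penalized hc0 hjb hγ x) ⟨y, rfl⟩

theorem exists_lt_of_lt_penalizedSup {a : ℝ} {x : E} (h : a < penalizedSup c j γ x) :
    ∃ y, a < j y - γ * c x y := by
  obtain ⟨s, ⟨y, rfl⟩, hs⟩ := exists_lt_of_lt_csSup
    (s := {s : ℝ | ∃ y, s = j y - γ * c x y}) ⟨_, x, rfl⟩ h
  exact ⟨y, hs⟩

theorem abs_penalizedSup_le (hc0 : ∀ x y, 0 ≤ c x y) (hcd : ∀ x, c x x = 0)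
    (hjb : ∀ x, |j x| ≤ M) (hγ : 0 ≤ γ) (x : E) : |penalizedSup c j γ x| ≤ M := by
  refine abs_le.2 ⟨?_, csSup_le ⟨_, x, rfl⟩ ?_⟩
  · have := le_penalizedSup hc0 hjb hγ x x
    rw [hcd, mul_zero, sub_zero] at this
    linarith [(abs_le.1 (hjb x)).1]
  · rintro s ⟨y, rfl⟩
    linarith [(abs_le.1 (hjb y)).2, mul_nonneg hγ (hc0 x y)]

end Pointwise

section Duality

variable {E : Type*} [TopologicalSpace E] [MeasurableSpace E] [BorelSpace E]
  {c : E → E → ℝ} {j : E → ℝ} {M γ b : ℝ} {μ : Measure E} {ν : Measure (E × E)}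

theorem measurable_penalizedSup (hc : Continuous fun z : E × E => c z.1 z.2)
    (hc0 : ∀ x y, 0 ≤ c x y) (hjb : ∀ x, |j x| ≤ M) (hγ : 0 ≤ γ) :
    Measurable (penalizedSup c j γ) := by
  refine measurable_of_Ioi fun a => IsOpen.measurableSet ?_
  have : penalizedSup c j γ ⁻¹' Set.Ioi a = ⋃ y, {x | a < j y - γ * c x y} := by
    ext x
    simp only [Set.mem_preimage, Set.mem_Ioi, Set.mem_iUnion, Set.mem_ofPred_eq]
    exact ⟨exists_lt_of_lt_penalizedSup,
      fun ⟨y, hy⟩ => hy.trans_le (le_penalizedSup hc0 hjb hγ x y)⟩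
  rw [this]
  refine isOpen_iUnion fun y => isOpen_lt continuous_const ?_
  have : Continuous fun x => c x y := hc.comp (continuous_id.prodMk continuous_const)
  fun_prop

theorem integrable_penalizedSup [IsFiniteMeasure μ] (hc : Continuous fun z : E × E => c z.1 z.2)
    (hc0 : ∀ x y, 0 ≤ c x y) (hcd : ∀ x, c x x = 0) (hjb : ∀ x, |j x| ≤ M) (hγ : 0 ≤ γ) :
    Integrable (penalizedSup c j γ) μ :=
  Integrable.of_bound (measurable_penalizedSup hc hc0 hjb hγ).aestronglyMeasurable M
    (Filter.Eventually.of_forall fun x => abs_penalizedSup_le hc0 hcd hjb hγ x)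

theorem integrable_snd [IsFiniteMeasure ν] (hj : Continuous j) (hjb : ∀ x, |j x| ≤ M) :
    Integrable (fun z : E × E => j z.2) ν :=
  Integrable.of_bound (hj.measurable.comp measurable_snd).aestronglyMeasurable M
    (Filter.Eventually.of_forall fun z => hjb z.2)

/-- The slackness of a feasible coupling integrates to at most its duality gap. -/
theorem integrable_slack (hc : Continuous fun z : E × E => c z.1 z.2)
    (hc0 : ∀ x y, 0 ≤ c x y) (hcd : ∀ x, c x x = 0) (hj : Continuous j) (hjb : ∀ x, |j x| ≤ M)
    (hγ : 0 ≤ γ) (hν : IsFeasibleCoupling c μ b ν) :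
    Integrable (fun z : E × E => penalizedSup c j γ z.1 - (j z.2 - γ * c z.1 z.2)) ν ∧
      ∫ z, (penalizedSup c j γ z.1 - (j z.2 - γ * c z.1 z.2)) ∂ν
        ≤ γ * b + ∫ x, penalizedSup c j γ x ∂μ - ∫ z, j z.2 ∂ν := by
  have := hν.prob
  have i1 : Integrable (fun z : E × E => penalizedSup c j γ z.1) ν :=
    Integrable.of_bound ((measurable_penalizedSup hc hc0 hjb hγ).comp
      measurable_fst).aestronglyMeasurable M
      (Filter.Eventually.of_forall fun z => abs_penalizedSup_le hc0 hcd hjb hγ z.1)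
  have i2 : Integrable (fun z : E × E => j z.2) ν := integrable_snd hj hjb
  have i3 : Integrable (fun z : E × E => γ * c z.1 z.2) ν := hν.integrable.const_mul γ
  have i23 : Integrable (fun z : E × E => j z.2 - γ * c z.1 z.2) ν := i2.sub i3
  have hmap : ∫ x, penalizedSup c j γ x ∂μ = ∫ z, penalizedSup c j γ z.1 ∂ν := by
    rw [← hν.fst, integral_map measurable_fst.aemeasurable
      (measurable_penalizedSup hc hc0 hjb hγ).aestronglyMeasurable]
  refine ⟨i1.sub i23, ?_⟩
  rw [integral_sub i1 i23, integral_sub i2 i3, integral_const_mul, hmap]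
  linarith [mul_le_mul_of_nonneg_left hν.cost hγ]

theorem weak_duality (hc : Continuous fun z : E × E => c z.1 z.2)
    (hc0 : ∀ x y, 0 ≤ c x y) (hcd : ∀ x, c x x = 0) (hj : Continuous j) (hjb : ∀ x, |j x| ≤ M)
    (hγ : 0 ≤ γ) (hν : IsFeasibleCoupling c μ b ν) :
    ∫ z, j z.2 ∂ν ≤ γ * b + ∫ x, penalizedSup c j γ x ∂μ := by
  have h1 := (integrable_slack hc hc0 hcd hj hjb hγ hν).2
  have h2 : 0 ≤ ∫ z, (penalizedSup c j γ z.1 - (j z.2 - γ * c z.1 z.2)) ∂ν :=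
    integral_nonneg fun z => sub_nonneg.2 (le_penalizedSup hc0 hjb hγ z.1 z.2)
  linarith

theorem convex_cost_value (hj : Continuous j) (hjb : ∀ x, |j x| ≤ M) :
    Convex ℝ {p : ℝ × ℝ | ∃ ν : Measure (E × E), IsFeasibleCoupling c μ p.1 ν ∧
      p.2 = ∫ z, j z.2 ∂ν} := by
  rintro p ⟨ν₁, h₁, hp⟩ q ⟨ν₂, h₂, hq⟩ s t hs ht hst
  have := h₁.prob
  have := h₂.prob
  have e : ∀ f : E × E → ℝ, Integrable f ν₁ → Integrable f ν₂ →
      ∫ z, f z ∂(ENNReal.ofReal s • ν₁ + ENNReal.ofReal t • ν₂)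
        = s * ∫ z, f z ∂ν₁ + t * ∫ z, f z ∂ν₂ := by
    intro f hf₁ hf₂
    rw [integral_add_measure (hf₁.smul_measure ENNReal.ofReal_ne_top)
      (hf₂.smul_measure ENNReal.ofReal_ne_top), integral_smul_measure, integral_smul_measure,
      ENNReal.toReal_ofReal hs, ENNReal.toReal_ofReal ht, smul_eq_mul, smul_eq_mul]
  have hone : ENNReal.ofReal s + ENNReal.ofReal t = 1 := by
    rw [← ENNReal.ofReal_add hs ht, hst, ENNReal.ofReal_one]
  refine ⟨ENNReal.ofReal s • ν₁ + ENNReal.ofReal t • ν₂, ⟨⟨?_⟩, ?_, ?_, ?_⟩, ?_⟩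
  · simp [hone]
  · rw [Measure.map_add _ _ measurable_fst, Measure.map_smul, Measure.map_smul, h₁.fst, h₂.fst,
      ← add_smul, hone, one_smul]
  · exact (h₁.integrable.smul_measure ENNReal.ofReal_ne_top).add_measure
      (h₂.integrable.smul_measure ENNReal.ofReal_ne_top)
  · rw [e _ h₁.integrable h₂.integrable]
    exact add_le_add (mul_le_mul_of_nonneg_left h₁.cost hs) (mul_le_mul_of_nonneg_left h₂.cost ht)
  · rw [e _ (integrable_snd hj hjb) (integrable_snd hj hjb)]
    simp [hp, hq]

variable [SecondCountableTopology E]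

/-- Measurable selection of approximate maximizers with bounded transport cost. -/
theorem exists_measurable_near_max (hc : Continuous fun z : E × E => c z.1 z.2)
    (hc0 : ∀ x y, 0 ≤ c x y) (hcd : ∀ x, c x x = 0) (hj : Continuous j) (hjb : ∀ x, |j x| ≤ M)
    (hμ : ∀ y, ∃ C, ∀ᵐ x ∂μ, c x y ≤ C) [Nonempty E] (hγ : 0 ≤ γ) {ε : ℝ} (hε : 0 < ε) :
    ∃ T : E → E, Measurable T ∧ (∃ C, ∀ᵐ x ∂μ, c x (T x) ≤ C) ∧
      ∀ x, penalizedSup c j γ x - ε ≤ j (T x) - γ * c x (T x) := by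
  rcases hγ.eq_or_lt with rfl | hγ'
  · obtain ⟨x₀⟩ := ‹Nonempty E›
    obtain ⟨y, hy⟩ := exists_lt_of_lt_penalizedSup (sub_lt_self (penalizedSup c j 0 x₀) hε)
    refine ⟨fun _ => y, measurable_const, hμ y, fun x => ?_⟩
    simp only [penalizedSup, zero_mul, sub_zero] at hy ⊢
    exact hy.le
  · have hex : ∀ x, ∃ n, penalizedSup c j γ x - ε
        < j (TopologicalSpace.denseSeq E n) - γ * c x (TopologicalSpace.denseSeq E n) := by
      intro x
      have hcx : Continuous fun y => c x y := hc.comp (continuous_const.prodMk continuous_id)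
      exact (TopologicalSpace.denseRange_denseSeq E).exists_mem_open
        (isOpen_lt (f := fun _ => penalizedSup c j γ x - ε) (g := fun y => j y - γ * c x y)
          continuous_const (by fun_prop))
        (exists_lt_of_lt_penalizedSup (sub_lt_self _ hε))
    classical
    refine ⟨fun x => TopologicalSpace.denseSeq E (Nat.find (hex x)), ?_,
      ⟨(2 * M + ε) / γ, Filter.Eventually.of_forall fun x => ?_⟩,
      fun x => (Nat.find_spec (hex x)).le⟩
    · refine (measurable_from_nat (f := TopologicalSpace.denseSeq E)).comp
        (measurable_find hex fun n => ?_)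
      refine measurableSet_lt ((measurable_penalizedSup hc hc0 hjb hγ).sub_const ε) ?_
      have : Measurable fun x => c x (TopologicalSpace.denseSeq E n) :=
        (hc.comp (continuous_id.prodMk continuous_const)).measurable
      fun_prop
    · have h1 := Nat.find_spec (hex x)
      have h2 := (abs_le.1 (abs_penalizedSup_le hc0 hcd hjb hγ x)).1
      have h3 := (abs_le.1 (hjb (TopologicalSpace.denseSeq E (Nat.find (hex x))))).2
      rw [le_div_iff₀ hγ']
      linarith

theorem isFeasibleCoupling_map [IsProbabilityMeasure μ]
    (hc : Continuous fun z : E × E => c z.1 z.2) (hc0 : ∀ x y, 0 ≤ c x y)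
    {T : E → E} (hT : Measurable T) (hC : ∃ C, ∀ᵐ x ∂μ, c x (T x) ≤ C) :
    IsFeasibleCoupling c μ (∫ x, c x (T x) ∂μ) (μ.map fun x => (x, T x)) ∧
      Integrable (fun x => c x (T x)) μ := by
  obtain ⟨C, hC⟩ := hC
  have hm : Measurable fun x => (x, T x) := measurable_id.prodMk hT
  have hi : Integrable (fun x => c x (T x)) μ := by
    refine Integrable.of_bound (hc.measurable.comp hm).aestronglyMeasurable C ?_
    filter_upwards [hC] with x hx
    rwa [Real.norm_of_nonneg (hc0 _ _)]
  refine ⟨⟨Measure.isProbabilityMeasure_map hm.aemeasurable, ?_, ?_, ?_⟩, hi⟩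
  · rw [Measure.map_map measurable_fst hm]
    exact Measure.map_id
  · rwa [integrable_map_measure hc.measurable.aestronglyMeasurable hm.aemeasurable]
  · rw [integral_map hm.aemeasurable hc.measurable.aestronglyMeasurable]

/-- Existence of a dual multiplier that closes the duality gap. -/
theorem exists_dual_le [IsProbabilityMeasure μ] (hc : Continuous fun z : E × E => c z.1 z.2)
    (hc0 : ∀ x y, 0 ≤ c x y) (hcd : ∀ x, c x x = 0) (hj : Continuous j) (hjb : ∀ x, |j x| ≤ M)
    (hμ : ∀ y, ∃ C, ∀ᵐ x ∂μ, c x y ≤ C) (hb : 0 < b) {V : ℝ}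
    (hV : ∀ ν : Measure (E × E), IsFeasibleCoupling c μ b ν → ∫ z, j z.2 ∂ν ≤ V) :
    ∃ γ, 0 ≤ γ ∧ γ * b + ∫ x, penalizedSup c j γ x ∂μ ≤ V := by
  obtain ⟨γ, hγ, hsup⟩ := exists_nonneg_slope_of_convex (V := V) (b := b)
    (convex_cost_value (c := c) (μ := μ) hj hjb)
    ⟨(0, _), ⟨_, by
      simpa [hcd] using (isFeasibleCoupling_map (μ := μ) hc hc0 measurable_id
        ⟨0, Filter.Eventually.of_forall fun x => (hcd x).le⟩).1, rfl⟩, hb⟩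
    (by
      rintro ⟨t, v⟩ ⟨ν, hν, hv⟩ ht
      exact hv.trans_le (hV ν ⟨hν.prob, hν.fst, hν.integrable, hν.cost.trans ht⟩))
  have : Nonempty E := nonempty_of_isProbabilityMeasure μ
  refine ⟨γ, hγ, le_of_forall_pos_le_add fun ε hε => ?_⟩
  obtain ⟨T, hT, hC, hTmax⟩ := exists_measurable_near_max hc hc0 hcd hj hjb hμ hγ hε
  obtain ⟨hfeas, hci⟩ := isFeasibleCoupling_map hc hc0 hT hC
  have hline := hsup (_, _) ⟨_, hfeas, rfl⟩
  have hji : Integrable (fun x => j (T x)) μ :=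
    Integrable.of_bound (hj.measurable.comp hT).aestronglyMeasurable M
      (Filter.Eventually.of_forall fun x => hjb _)
  have hm : Measurable fun x => (x, T x) := measurable_id.prodMk hT
  simp only at hline
  rw [integral_map hm.aemeasurable (f := fun z : E × E => j z.2)
    (hj.measurable.comp measurable_snd).aestronglyMeasurable] at hline
  have hpi := integrable_penalizedSup (μ := μ) hc hc0 hcd hjb hγ
  have hint := integral_mono (hpi.sub (integrable_const ε)) (hji.sub (hci.const_mul γ)) hTmax
  simp only [Pi.sub_apply] at hint
  rw [integral_sub hpi (integrable_const ε), integral_sub hji (hci.const_mul γ),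
    integral_const_mul] at hint
  simp only [integral_const, probReal_univ, one_smul] at hint
  linarith

/-- Strong duality and complementary slackness for transport-constrained maximization. -/
theorem strong_duality [IsProbabilityMeasure μ] (hc : Continuous fun z : E × E => c z.1 z.2)
    (hc0 : ∀ x y, 0 ≤ c x y) (hcd : ∀ x, c x x = 0) (hj : Continuous j) (hjb : ∀ x, |j x| ≤ M)
    (hμ : ∀ y, ∃ C, ∀ᵐ x ∂μ, c x y ≤ C) (hb : 0 < b) :
    ∃ γ, 0 ≤ γ ∧
      IsLeast {v : ℝ | ∃ γ : ℝ, 0 ≤ γ ∧ v = γ * b + ∫ x, penalizedSup c j γ x ∂μ}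
        (γ * b + ∫ x, penalizedSup c j γ x ∂μ) ∧
      IsLUB {v : ℝ | ∃ ν : Measure (E × E), IsFeasibleCoupling c μ b ν ∧ v = ∫ z, j z.2 ∂ν}
        (γ * b + ∫ x, penalizedSup c j γ x ∂μ) ∧
      ∀ ν : Measure (E × E), IsFeasibleCoupling c μ b ν →
        ∫ z, j z.2 ∂ν = γ * b + ∫ x, penalizedSup c j γ x ∂μ →
        ∀ᵐ z ∂ν, ∀ y, j y - γ * c z.1 y ≤ j z.2 - γ * c z.1 z.2 := by
  set P : Set ℝ := {v : ℝ | ∃ ν : Measure (E × E), IsFeasibleCoupling c μ b ν ∧ v = ∫ z, j z.2 ∂ν}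
  have hPne : P.Nonempty := by
    obtain ⟨h, -⟩ := isFeasibleCoupling_map (μ := μ) hc hc0 measurable_id
      ⟨0, Filter.Eventually.of_forall fun x => (hcd x).le⟩
    exact ⟨_, _, ⟨h.prob, h.fst, h.integrable, h.cost.trans (by simpa [hcd] using hb.le)⟩, rfl⟩
  have hPub : ∀ γ, 0 ≤ γ → γ * b + ∫ x, penalizedSup c j γ x ∂μ ∈ upperBounds P := by
    rintro γ hγ v ⟨ν, hν, rfl⟩
    exact weak_duality hc hc0 hcd hj hjb hγ hν
  obtain ⟨γ, hγ, hle⟩ := exists_dual_le (V := sSup P) hc hc0 hcd hj hjb hμ hb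
    fun ν hν => le_csSup ⟨_, hPub 0 le_rfl⟩ ⟨ν, hν, rfl⟩
  refine ⟨γ, hγ, ⟨⟨γ, hγ, rfl⟩, ?_⟩, ⟨hPub γ hγ, fun u hu => hle.trans (csSup_le hPne hu)⟩, ?_⟩
  · rintro v ⟨γ', hγ', rfl⟩
    exact hle.trans (csSup_le hPne (hPub γ' hγ'))
  · intro ν hν hopt
    obtain ⟨hi, hgap⟩ := integrable_slack hc hc0 hcd hj hjb hγ hν
    have hnn : 0 ≤ fun z : E × E => penalizedSup c j γ z.1 - (j z.2 - γ * c z.1 z.2) :=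
      fun z => sub_nonneg.2 (le_penalizedSup hc0 hjb hγ z.1 z.2)
    have hzero := (integral_eq_zero_iff_of_nonneg hnn hi).1
      (le_antisymm (by linarith) (integral_nonneg hnn))
    filter_upwards [hzero] with z hz y
    have := le_penalizedSup hc0 hjb hγ z.1 y
    simp only [Pi.zero_apply] at hz
    linarith

end Duality

open MeasureTheory Real

/-- **Strong duality for the distributionally robust maximization problem** (Proposition 2.12).
For a bounded continuous loss `j`, a norm `N`, `r ≥ 1` and budget `δ > 0`,
`sup_{ν ∈ F} ∫ j(x̃) dν = inf_{γ ≥ 0} { γ δ^r + ∫ j^γ dμ₀ }` where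
`j^γ(x) = sup_{x̃} { j(x̃) − γ N(x − x̃)^r }`; moreover any maximizer `ν*` is supported on
argmaxes of `x̃ ↦ j(x̃) − γ* N(x − x̃)^r` for some optimal `γ*`. -/
theorem stmt_3
    {d : ℕ}
    (N : EuclideanSpace ℝ (Fin d) → ℝ)
    (hN0 : ∀ x, N x = 0 ↔ x = 0)
    (hNsmul : ∀ (a : ℝ) (x : EuclideanSpace ℝ (Fin d)), N (a • x) = |a| * N x)
    (hNadd : ∀ x y, N (x + y) ≤ N x + N y)
    (μ₀ : Measure (EuclideanSpace ℝ (Fin d))) [IsProbabilityMeasure μ₀]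
    (hsupp : ∃ K : Set (EuclideanSpace ℝ (Fin d)), Bornology.IsBounded K ∧ μ₀ Kᶜ = 0)
    (j : EuclideanSpace ℝ (Fin d) → ℝ) (hjc : Continuous j)
    (M : ℝ) (hjb : ∀ x, |j x| ≤ M)
    (r δ : ℝ) (hr : 1 ≤ r) (hδ : 0 < δ) :
    sSup {v : ℝ |
        ∃ ν : Measure (EuclideanSpace ℝ (Fin d) × EuclideanSpace ℝ (Fin d)),
          IsProbabilityMeasure ν ∧ ν.map Prod.fst = μ₀ ∧
          (∫⁻ z, ENNReal.ofReal (N (z.1 - z.2) ^ r) ∂ν) ≤ ENNReal.ofReal (δ ^ r) ∧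
          v = ∫ z, j z.2 ∂ν}
      = sInf {v : ℝ | ∃ γ : ℝ, 0 ≤ γ ∧
          v = γ * δ ^ r + ∫ x, sSup {s : ℝ | ∃ y, s = j y - γ * N (x - y) ^ r} ∂μ₀}
    ∧ ∀ ν : Measure (EuclideanSpace ℝ (Fin d) × EuclideanSpace ℝ (Fin d)),
        IsProbabilityMeasure ν → ν.map Prod.fst = μ₀ →
        (∫⁻ z, ENNReal.ofReal (N (z.1 - z.2) ^ r) ∂ν) ≤ ENNReal.ofReal (δ ^ r) →
        (∫ z, j z.2 ∂ν) = sSup {v : ℝ |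
            ∃ ν' : Measure (EuclideanSpace ℝ (Fin d) × EuclideanSpace ℝ (Fin d)),
              IsProbabilityMeasure ν' ∧ ν'.map Prod.fst = μ₀ ∧
              (∫⁻ z, ENNReal.ofReal (N (z.1 - z.2) ^ r) ∂ν') ≤ ENNReal.ofReal (δ ^ r) ∧
              v = ∫ z, j z.2 ∂ν'} →
        ∃ γstar : ℝ, 0 ≤ γstar ∧
          (γstar * δ ^ r + ∫ x, sSup {s : ℝ | ∃ y, s = j y - γstar * N (x - y) ^ r} ∂μ₀
            = sInf {v : ℝ | ∃ γ : ℝ, 0 ≤ γ ∧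
                v = γ * δ ^ r + ∫ x, sSup {s : ℝ | ∃ y, s = j y - γ * N (x - y) ^ r} ∂μ₀}) ∧
          ∀ᵐ z ∂ν, ∀ y, j y - γstar * N (z.1 - y) ^ r ≤ j z.2 - γstar * N (z.1 - z.2) ^ r := by
  have hN_nonneg : ∀ x, 0 ≤ N x := fun x => by
    have h := hNadd x ((-1 : ℝ) • x)
    rw [hNsmul, neg_one_smul, add_neg_cancel, (hN0 0).2 rfl] at h
    norm_num at h
    linarith
  have hNcont : Continuous N := by
    let p : Seminorm ℝ (EuclideanSpace ℝ (Fin d)) := Seminorm.of N hNadd hNsmul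
    exact continuousOn_univ.1 (p.convexOn.continuousOn isOpen_univ)
  have hr0 : 0 < r := by linarith
  set c : EuclideanSpace ℝ (Fin d) → EuclideanSpace ℝ (Fin d) → ℝ := fun x y => N (x - y) ^ r
    with hc_def
  have hc : Continuous fun z : EuclideanSpace ℝ (Fin d) × EuclideanSpace ℝ (Fin d) => c z.1 z.2 :=
    (hNcont.comp (continuous_fst.sub continuous_snd)).rpow_const fun _ => Or.inr hr0.le
  have hc0 : ∀ x y, 0 ≤ c x y := fun x y => Real.rpow_nonneg (hN_nonneg _) _
  have hcd : ∀ x, c x x = 0 := fun x => by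
    simp only [hc_def, sub_self, (hN0 0).2 rfl, Real.zero_rpow hr0.ne']
  have hμ : ∀ y, ∃ C, ∀ᵐ x ∂μ₀, c x y ≤ C := by
    intro y
    obtain ⟨K, hK, hK0⟩ := hsupp
    have hcy : Continuous fun x => c x y := hc.comp (continuous_id.prodMk continuous_const)
    obtain ⟨C, hC⟩ := (hK.isCompact_closure.image hcy).bddAbove
    refine ⟨C, ?_⟩
    filter_upwards [show ∀ᵐ x ∂μ₀, x ∈ K from hK0] with x hx
    exact hC ⟨x, subset_closure hx, rfl⟩
  have hb : 0 < δ ^ r := Real.rpow_pos_of_pos hδ r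
  have hfeas : ∀ ν : Measure (EuclideanSpace ℝ (Fin d) × EuclideanSpace ℝ (Fin d)),
      IsFeasibleCoupling c μ₀ (δ ^ r) ν ↔ IsProbabilityMeasure ν ∧ ν.map Prod.fst = μ₀ ∧
        (∫⁻ z, ENNReal.ofReal (N (z.1 - z.2) ^ r) ∂ν) ≤ ENNReal.ofReal (δ ^ r) := by
    intro ν
    have hnn : 0 ≤ᵐ[ν] fun z => c z.1 z.2 := Filter.Eventually.of_forall fun z => hc0 _ _
    constructor
    · rintro ⟨h1, h2, h3, h4⟩
      refine ⟨h1, h2, ?_⟩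
      rw [← ofReal_integral_eq_lintegral_ofReal h3 hnn]
      exact ENNReal.ofReal_le_ofReal h4
    · rintro ⟨h1, h2, h3⟩
      have hi : Integrable (fun z => c z.1 z.2) ν := by
        refine ⟨hc.measurable.aestronglyMeasurable, ?_⟩
        rw [hasFiniteIntegral_iff_ofReal hnn]
        exact h3.trans_lt ENNReal.ofReal_lt_top
      refine ⟨h1, h2, hi, ?_⟩
      rw [← ofReal_integral_eq_lintegral_ofReal hi hnn] at h3
      exact (ENNReal.ofReal_le_ofReal_iff hb.le).1 h3
  obtain ⟨γ, hγ, hleast, hlub, hslack⟩ := strong_duality hc hc0 hcd hjc hjb hμ hb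
  simp only [hfeas, and_assoc] at hlub
  have hsup := hlub.csSup_eq hlub.nonempty
  have hinf := hleast.csInf_eq
  refine ⟨hsup.trans hinf.symm, fun ν h1 h2 h3 h4 => ⟨γ, hγ, hinf.symm, ?_⟩⟩
  exact hslack ν ((hfeas ν).2 ⟨h1, h2, h3⟩) (h4.trans hsup)
end

section
/- Let T > 0, let A : [0,T] → ℝ^{d×d} and b : [0,T] → ℝ^d be continuous, and let g ∈ ℝ^d. Suppose P, ζ : [0,T] → ℝ^d are differentiable and satisfy, for all t ∈ [0,T]: P′(t) = −A(t)ᵀ P(t) + b(t) with terminal condition P(T) = −g, and ζ′(t) = A(t) ζ(t). Then ⟨g, ζ(T)⟩ + ∫₀ᵀ ⟨b(t), ζ(t)⟩ dt = −⟨P(0), ζ(0)⟩. -/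
open MeasureTheory Matrix

/-- Product rule for the dot product of two vector-valued curves. -/
theorem HasDerivAt.dotProduct {ι : Type*} [Fintype ι] {u v : ℝ → ι → ℝ} {u' v' : ι → ℝ} {t : ℝ}
    (hu : HasDerivAt u u' t) (hv : HasDerivAt v v' t) :
    HasDerivAt (fun s => u s ⬝ᵥ v s) (u' ⬝ᵥ v t + u t ⬝ᵥ v') t := by
  simp only [_root_.dotProduct, ← Finset.sum_add_distrib]
  exact HasDerivAt.fun_sum fun i _ => (hasDerivAt_pi.1 hu i).mul (hasDerivAt_pi.1 hv i)

/-- **The adjoint state is the input-gradient of the loss** (integration-by-parts identity of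
Section 4). If `P` solves the backward adjoint equation `P′ = −Aᵀ P + b`, `P(T) = −g`, and `ζ`
solves the variational equation `ζ′ = A ζ`, then
`⟨g, ζ(T)⟩ + ∫₀ᵀ ⟨b(t), ζ(t)⟩ dt = −⟨P(0), ζ(0)⟩`. -/
theorem stmt_4 {d : ℕ} (T : ℝ) (hT : 0 < T)
    (A : ℝ → Matrix (Fin d) (Fin d) ℝ) (b : ℝ → Fin d → ℝ)
    (hA : ContinuousOn A (Set.Icc 0 T)) (hb : ContinuousOn b (Set.Icc 0 T))
    (g : Fin d → ℝ) (P ζ : ℝ → Fin d → ℝ)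
    (hP : ∀ t ∈ Set.Icc (0:ℝ) T, HasDerivAt P (-((A t)ᵀ.mulVec (P t)) + b t) t)
    (hPT : P T = -g)
    (hζ : ∀ t ∈ Set.Icc (0:ℝ) T, HasDerivAt ζ ((A t).mulVec (ζ t)) t) :
    g ⬝ᵥ ζ T + ∫ t in (0:ℝ)..T, b t ⬝ᵥ ζ t = -(P 0 ⬝ᵥ ζ 0) := by
  have h_deriv : ∀ t ∈ Set.uIcc 0 T, HasDerivAt (fun s => P s ⬝ᵥ ζ s) (b t ⬝ᵥ ζ t) t := by
    intro t ht
    rw [Set.uIcc_of_le hT.le] at ht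
    convert (hP t ht).dotProduct (hζ t ht) using 1
    rw [add_dotProduct, neg_dotProduct, mulVec_transpose, ← dotProduct_mulVec]
    ring
  have hζ_cont : ContinuousOn ζ (Set.Icc 0 T) := fun t ht =>
    (hζ t ht).continuousAt.continuousWithinAt
  have h_int : IntervalIntegrable (fun t => b t ⬝ᵥ ζ t) volume 0 T := by
    apply ContinuousOn.intervalIntegrable
    rw [Set.uIcc_of_le hT.le]
    exact continuousOn_finsetSum _ fun i _ =>
      (continuousOn_pi.1 hb i).mul (continuousOn_pi.1 hζ_cont i)
  rw [intervalIntegral.integral_eq_sub_of_hasDerivAt h_deriv h_int, hPT, neg_dotProduct]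
  ring
end
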